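/- (Green's structure theorem for coalgebras.) Let C be a coalgebra and F a full set of indecomposable injective covers of the simple C-comodules. Then there is a subfamily F' ⊆ F and cardinal multiplicities m_I such that σ(C) ≅ ⊕_{I∈F'} m_I σ(I) and C ≅ ⊕_{I∈F'} m_I I as right C-comodules; i.e. C decomposes as a direct sum of indecomposable injective comodules, each copy of a socle summand being contained in a copy of its injective cover. -/

import Mathlib

open TensorProduct

namespace SuperCoalg

variable (k : Type) [Field k]
variable (C : Type) [AddCommGroup C] [Module k C] [Coalgebra k C]

/-- `β : V →ₗ[k] V ⊗[k] C` is a (right) comodule structure map over the coalgebra `C`. -/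
structure IsComodule {V : Type} [AddCommGroup V] [Module k V]
    (β : V →ₗ[k] V ⊗[k] C) : Prop where
  coassoc : (TensorProduct.assoc k V C C).toLinearMap ∘ₗ β.rTensor C ∘ₗ β
      = LinearMap.lTensor V (Coalgebra.comul (R := k) (A := C)) ∘ₗ β
  counit_id : (TensorProduct.rid k V).toLinearMap ∘ₗ
      LinearMap.lTensor V (Coalgebra.counit (R := k) (A := C)) ∘ₗ β = LinearMap.id

/-- A bundled right `C`-comodule. -/
structure Comod where
  V : Type
  [addCommGroup : AddCommGroup V]
  [module : Module k V]
  β : V →ₗ[k] V ⊗[k] C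
  isComodule : IsComodule k C β

attribute [instance] Comod.addCommGroup Comod.module

variable {k C}

/-- A submodule `W ≤ V` is a subcomodule for the structure map `β`. -/
def IsSubcomodule {V : Type} [AddCommGroup V] [Module k V]
    (β : V →ₗ[k] V ⊗[k] C) (W : Submodule k V) : Prop :=
  ∀ w ∈ W, β w ∈ LinearMap.range (W.subtype.rTensor C)

/-- `f` is a homomorphism of right `C`-comodules from `(V, β)` to `(W, γ)`. -/
def IsComodHom {V W : Type} [AddCommGroup V] [Module k V] [AddCommGroup W] [Module k W]
    (β : V →ₗ[k] V ⊗[k] C) (γ : W →ₗ[k] W ⊗[k] C) (f : V →ₗ[k] W) : Prop :=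
  f.rTensor C ∘ₗ β = γ ∘ₗ f

/-- A subcomodule is simple if it is nonzero and has no nonzero proper subcomodules. -/
def IsSimpleSubcomodule {V : Type} [AddCommGroup V] [Module k V]
    (β : V →ₗ[k] V ⊗[k] C) (W : Submodule k V) : Prop :=
  IsSubcomodule β W ∧ W ≠ ⊥ ∧
    ∀ U : Submodule k V, U ≤ W → IsSubcomodule β U → U = ⊥ ∨ U = W

/-- The socle of the comodule `(V, β)`: the sum of all its simple subcomodules. -/
def socle {V : Type} [AddCommGroup V] [Module k V]
    (β : V →ₗ[k] V ⊗[k] C) : Submodule k V :=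
  sSup {W : Submodule k V | IsSimpleSubcomodule β W}

/-- A comodule is simple if it is nonzero and has no nonzero proper subcomodules. -/
def IsSimpleComod (M : Comod k C) : Prop :=
  Nontrivial M.V ∧ ∀ W : Submodule k M.V, IsSubcomodule M.β W → W = ⊥ ∨ W = ⊤

/-- A comodule is indecomposable if it is nonzero and is not the direct sum of two
nonzero subcomodules. -/
def IsIndecomposableComod (M : Comod k C) : Prop :=
  Nontrivial M.V ∧ ∀ W W' : Submodule k M.V,
    IsSubcomodule M.β W → IsSubcomodule M.β W' → IsCompl W W' → W = ⊥ ∨ W' = ⊥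

/-- A comodule is injective if it splits off every comodule containing it as a
subcomodule. -/
def IsInjectiveComod (M : Comod k C) : Prop :=
  ∀ (W : Comod k C) (g : M.V →ₗ[k] W.V),
    IsComodHom M.β W.β g → Function.Injective g →
      ∃ X' : Submodule k W.V, IsSubcomodule W.β X' ∧ IsCompl (LinearMap.range g) X'

/-- `N` is an injective cover of the simple comodule `S`: `N` is indecomposable,
injective, and its socle is a copy of `S`. -/
def IsInjectiveCover (N S : Comod k C) : Prop :=
  IsIndecomposableComod N ∧ IsInjectiveComod N ∧
    ∃ g : S.V →ₗ[k] N.V, IsComodHom S.β N.β g ∧ Function.Injective g ∧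
      LinearMap.range g = socle N.β

/-- The coefficient map `φ_V : V* ⊗ V → C` of a comodule `(V, β)`, given by right linear
extension of forms, `φ_V (ω ⊗ v) = (ω ⊗ id) (β v)`. -/
noncomputable def coeffMap {V : Type} [AddCommGroup V] [Module k V]
    (β : V →ₗ[k] V ⊗[k] C) : (Module.Dual k V) ⊗[k] V →ₗ[k] C :=
  (TensorProduct.lid k C).toLinearMap ∘ₗ
    (contractLeft k V).rTensor C ∘ₗ
    (TensorProduct.assoc k (Module.Dual k V) V C).symm.toLinearMap ∘ₗ
    LinearMap.lTensor (Module.Dual k V) β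

open DirectSum

/-- The componentwise coaction on a direct sum of comodules. -/
noncomputable def dsCoaction {ι' : Type} (Vf : ι' → Type)
    [∀ i, AddCommGroup (Vf i)] [∀ i, Module k (Vf i)]
    (βf : ∀ i, Vf i →ₗ[k] Vf i ⊗[k] C) :
    (⨁ i, Vf i) →ₗ[k] (⨁ i, Vf i) ⊗[k] C :=
  letI := Classical.decEq ι'
  DirectSum.toModule k ι' ((⨁ i, Vf i) ⊗[k] C)
    (fun i => LinearMap.rTensor C (DirectSum.lof k ι' Vf i) ∘ₗ βf i)

/-! ### Operators attached to a comodule -/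

section helpers

set_option linter.unusedSectionVars false

variable {V W U : Type} [AddCommGroup V] [Module k V] [AddCommGroup W] [Module k W]
  [AddCommGroup U] [Module k U]

/-- Slicing by a functional on the right. -/
noncomputable def slice (V : Type) [AddCommGroup V] [Module k V] (f : C →ₗ[k] k) :
    V ⊗[k] C →ₗ[k] V :=
  (TensorProduct.rid k V).toLinearMap ∘ₗ LinearMap.lTensor V f

@[simp] lemma slice_tmul (f : C →ₗ[k] k) (v : V) (c : C) :
    slice V f (v ⊗ₜ[k] c) = f c • v := by simp [slice]

lemma slice_rTensor (f : C →ₗ[k] k) (g : V →ₗ[k] W) (x : V ⊗[k] C) :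
    slice W f (g.rTensor C x) = g (slice V f x) := by
  induction x with
  | zero => simp
  | tmul v c => simp
  | add x y hx hy => simp [hx, hy]

lemma eq_zero_of_slice (x : V ⊗[k] C) (h : ∀ f : C →ₗ[k] k, slice V f x = 0) : x = 0 := by
  classical
  let b := Module.Free.chooseBasis k C
  apply (TensorProduct.equivFinsuppOfBasisRight (M := V) b).injective
  ext i
  rw [TensorProduct.equivFinsuppOfBasisRight_apply]
  simpa [slice] using h (b.coord i)

lemma isSub_iff (β : V →ₗ[k] V ⊗[k] C) (S : Submodule k V) :
    IsSubcomodule β S ↔ ∀ f : C →ₗ[k] k, ∀ v ∈ S, slice V f (β v) ∈ S := by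
  constructor
  · intro h f v hv
    obtain ⟨y, hy⟩ := h v hv
    rw [← hy, slice_rTensor]
    exact (slice S f y).2
  · intro h v hv
    have hex := rTensor_exact C (f := S.subtype) (g := S.mkQ)
      (by intro x; simp) S.mkQ_surjective
    rw [LinearMap.exact_iff] at hex
    rw [← hex, LinearMap.mem_ker]
    apply eq_zero_of_slice
    intro f
    rw [slice_rTensor]
    simpa using h f v hv

lemma hom_slice {β : V →ₗ[k] V ⊗[k] C} {γ : W →ₗ[k] W ⊗[k] C} {g : V →ₗ[k] W}
    (hg : IsComodHom β γ g) (f : C →ₗ[k] k) (v : V) :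
    slice W f (γ (g v)) = g (slice V f (β v)) := by
  rw [← slice_rTensor]
  congr 1
  exact (LinearMap.congr_fun hg v).symm

lemma isSub_ker {β : V →ₗ[k] V ⊗[k] C} {γ : W →ₗ[k] W ⊗[k] C} {g : V →ₗ[k] W}
    (hg : IsComodHom β γ g) : IsSubcomodule β (LinearMap.ker g) := by
  rw [isSub_iff]
  intro f v hv
  rw [LinearMap.mem_ker] at hv ⊢
  rw [← hom_slice hg, hv]; simp

lemma isSub_map {β : V →ₗ[k] V ⊗[k] C} {γ : W →ₗ[k] W ⊗[k] C} {g : V →ₗ[k] W}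
    (hg : IsComodHom β γ g) {S : Submodule k V} (hS : IsSubcomodule β S) :
    IsSubcomodule γ (S.map g) := by
  rw [isSub_iff] at hS ⊢
  rintro f _ ⟨v, hv, rfl⟩
  rw [hom_slice hg]
  exact ⟨_, hS f v hv, rfl⟩

lemma isSub_comap {β : V →ₗ[k] V ⊗[k] C} {γ : W →ₗ[k] W ⊗[k] C} {g : V →ₗ[k] W}
    (hg : IsComodHom β γ g) {S : Submodule k W} (hS : IsSubcomodule γ S) :
    IsSubcomodule β (S.comap g) := by
  rw [isSub_iff] at hS ⊢
  intro f v hv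
  rw [Submodule.mem_comap] at hv ⊢
  rw [← hom_slice hg]
  exact hS f _ hv

lemma isSub_inf {β : V →ₗ[k] V ⊗[k] C} {S T : Submodule k V} (hS : IsSubcomodule β S)
    (hT : IsSubcomodule β T) : IsSubcomodule β (S ⊓ T) := by
  rw [isSub_iff] at *
  exact fun f v hv => ⟨hS f v hv.1, hT f v hv.2⟩

lemma isSub_sSup {β : V →ₗ[k] V ⊗[k] C} {s : Set (Submodule k V)}
    (hs : ∀ S ∈ s, IsSubcomodule β S) : IsSubcomodule β (sSup s) := by
  rw [isSub_iff]
  intro f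
  have : sSup s ≤ (sSup s).comap (slice V f ∘ₗ β) := by
    apply sSup_le
    intro S hS v hv
    exact le_sSup hS ((isSub_iff β S).1 (hs S hS) f v hv)
  exact fun v hv => this hv

lemma slice_slice {β : V →ₗ[k] V ⊗[k] C} (hβ : IsComodule k C β) (f g : C →ₗ[k] k) :
    ∃ h : C →ₗ[k] k, ∀ v, slice V g (β (slice V f (β v))) = slice V h (β v) := by
  let h : C ⊗[k] C →ₗ[k] k := (TensorProduct.lid k k).toLinearMap ∘ₗ TensorProduct.map g f
  refine ⟨h ∘ₗ Coalgebra.comul, fun v => ?_⟩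
  have h1 : ∀ z : V ⊗[k] C, ∀ c : C, (TensorProduct.rid k V) (LinearMap.lTensor V h
      ((TensorProduct.assoc k V C C) (z ⊗ₜ[k] c))) = f c • slice V g z := by
    intro z c
    induction z with
    | zero => simp
    | tmul v d => simp [h, smul_smul, mul_comm]
    | add x y hx hy => simp only [add_tmul, map_add, hx, hy, smul_add]
  have h2 : ∀ z : V ⊗[k] C, (TensorProduct.rid k V) (LinearMap.lTensor V h
      ((TensorProduct.assoc k V C C) (β.rTensor C z))) = slice V g (β (slice V f z)) := by
    intro z
    induction z with
    | zero => simp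
    | tmul v d => rw [LinearMap.rTensor_tmul, h1]; simp
    | add x y hx hy => simp only [map_add, hx, hy]
  rw [← h2]
  have := LinearMap.congr_fun hβ.coassoc v
  simp only [LinearMap.comp_apply, LinearEquiv.coe_coe] at this
  clear_value h
  rw [this, slice, LinearMap.comp_apply, LinearMap.lTensor_comp_apply]
  rfl

lemma exists_fd (z : V ⊗[k] C) : ∃ N : Submodule k V, FiniteDimensional k N ∧
    ∀ f : C →ₗ[k] k, slice V f z ∈ N := by
  induction z with
  | zero => exact ⟨⊥, inferInstance, by simp⟩
  | tmul v c =>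
    refine ⟨k ∙ v, inferInstance, fun f => ?_⟩
    rw [slice_tmul]
    exact Submodule.smul_mem _ _ (Submodule.mem_span_singleton_self v)
  | add x y hx hy =>
    obtain ⟨N, hN, h1⟩ := hx
    obtain ⟨M, hM, h2⟩ := hy
    refine ⟨N ⊔ M, inferInstance, fun f => ?_⟩
    rw [map_add]
    exact Submodule.add_mem_sup (h1 f) (h2 f)

lemma exists_fd_sub {β : V →ₗ[k] V ⊗[k] C} (hβ : IsComodule k C β) {S : Submodule k V}
    (hS : IsSubcomodule β S) {v : V} (hv : v ∈ S) :
    ∃ N : Submodule k V, FiniteDimensional k N ∧ IsSubcomodule β N ∧ v ∈ N ∧ N ≤ S := by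
  obtain ⟨N, hN, h1⟩ := exists_fd (β v)
  let L : (C →ₗ[k] k) →ₗ[k] V :=
    { toFun := fun f => slice V f (β v)
      map_add' := by intro f g; simp [slice, LinearMap.lTensor_add]
      map_smul' := by intro f g; simp [slice, LinearMap.lTensor_smul] }
  refine ⟨LinearMap.range L, ?_, ?_, ?_, ?_⟩
  · apply Submodule.finiteDimensional_of_le (S₂ := N)
    rintro _ ⟨f, rfl⟩
    exact h1 f
  · rw [isSub_iff]
    rintro g _ ⟨f, rfl⟩
    obtain ⟨h, hh⟩ := slice_slice hβ f g
    exact ⟨h, (hh v).symm⟩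
  · refine ⟨Coalgebra.counit, ?_⟩
    exact LinearMap.congr_fun hβ.counit_id v
  · rintro _ ⟨f, rfl⟩
    exact (isSub_iff β S).1 hS f v hv

lemma exists_simple {β : V →ₗ[k] V ⊗[k] C} (hβ : IsComodule k C β) {S : Submodule k V}
    (hS : IsSubcomodule β S) (hne : S ≠ ⊥) :
    ∃ T, T ≤ S ∧ IsSimpleSubcomodule β T := by
  classical
  let P : ℕ → Prop := fun n => ∃ N : Submodule k V, FiniteDimensional k N ∧ IsSubcomodule β N ∧
    N ≠ ⊥ ∧ N ≤ S ∧ Module.finrank k N = n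
  have hP : ∃ n, P n := by
    obtain ⟨v, hv, h0⟩ := S.exists_mem_ne_zero_of_ne_bot hne
    obtain ⟨N, h1, h2, h3, h4⟩ := exists_fd_sub hβ hS hv
    exact ⟨_, N, h1, h2, fun h => h0 (by simpa [h] using h3), h4, rfl⟩
  obtain ⟨N, h1, h2, h3, h4, h5⟩ := Nat.find_spec hP
  refine ⟨N, h4, h2, h3, fun X hX hX' => ?_⟩
  by_cases hb : X = ⊥
  · exact Or.inl hb
  · right
    apply Submodule.eq_of_le_of_finrank_le hX
    rw [h5]
    exact Nat.find_min' hP ⟨X, Submodule.finiteDimensional_of_le hX, hX', hb, hX.trans h4, rfl⟩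

lemma eq_bot_of_disjoint_socle {β : V →ₗ[k] V ⊗[k] C} (hβ : IsComodule k C β)
    {S : Submodule k V} (hS : IsSubcomodule β S) (hd : S ⊓ socle β = ⊥) : S = ⊥ := by
  by_contra hne
  obtain ⟨T, hT, hs⟩ := exists_simple hβ hS hne
  apply hs.2.1
  rw [eq_bot_iff, ← hd]
  exact le_inf hT (le_sSup hs)

/-- Decomposition of the socle. -/
lemma exists_indep (β : V →ₗ[k] V ⊗[k] C) : ∃ s : Set (Submodule k V),
    sSupIndep s ∧ (∀ S ∈ s, IsSimpleSubcomodule β S) ∧ sSup s = socle β := by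
  have zorn := zorn_subset
    (S := {s : Set (Submodule k V) | sSupIndep s ∧ ∀ a ∈ s, IsSimpleSubcomodule β a})
    fun c hc1 hc2 =>
      ⟨⋃₀ c,
        ⟨iSupIndep_sUnion_of_directed hc2.directedOn fun s hs => (hc1 hs).1,
          fun a ⟨s, sc, as⟩ => (hc1 sc).2 a as⟩,
        fun _ => Set.subset_sUnion_of_mem⟩
  simp_rw [maximal_subset_iff] at zorn
  obtain ⟨s, ⟨s_ind, s_atoms⟩, s_max⟩ := zorn
  refine ⟨s, s_ind, s_atoms, le_antisymm (sSup_le_sSup s_atoms) ?_⟩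
  apply sSup_le
  intro a ha
  have ha' : IsSimpleSubcomodule β a := ha
  have hsub : IsSubcomodule β (a ⊓ sSup s) :=
    isSub_inf ha'.1 (isSub_sSup fun S hS => (s_atoms S hS).1)
  rcases ha'.2.2 _ inf_le_left hsub with con | con
  swap
  · exact inf_eq_left.1 con
  apply le_sSup
  rw [← disjoint_iff] at con
  rw [s_max ⟨fun x hx => ?_, fun x hx => ?_⟩ Set.subset_union_left]
  · exact Set.mem_union_right _ (Set.mem_singleton _)
  · rw [Set.mem_union, Set.mem_singleton_iff] at hx
    obtain rfl | xa := eq_or_ne x a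
    · simp only [Set.mem_singleton, Set.insert_sdiff_of_mem, Set.union_singleton]
      exact con.mono_right (sSup_le_sSup Set.sdiff_subset)
    · have h : (s ∪ {a}) \ {x} = s \ {x} ∪ {a} := by
        simp only [Set.union_singleton]
        rw [Set.insert_sdiff_of_notMem]
        rw [Set.mem_singleton_iff]
        exact Ne.symm xa
      rw [h, sSup_union, sSup_singleton]
      apply (s_ind (hx.resolve_right xa)).disjoint_sup_right_of_disjoint_sup_left
      refine (con.mono_right ?_).symm
      exact sup_le (le_sSup (hx.resolve_right xa)) (sSup_le_sSup Set.sdiff_subset)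
  · rcases hx with hx | hx
    · exact s_atoms x hx
    · rw [Set.mem_singleton_iff.1 hx]; exact ha'

lemma hom_apply {β : V →ₗ[k] V ⊗[k] C} {γ : W →ₗ[k] W ⊗[k] C} {g : V →ₗ[k] W}
    (hg : IsComodHom β γ g) (v : V) : γ (g v) = g.rTensor C (β v) :=
  (LinearMap.congr_fun hg v).symm

lemma hom_comp {β : V →ₗ[k] V ⊗[k] C} {γ : W →ₗ[k] W ⊗[k] C} {δ : U →ₗ[k] U ⊗[k] C}
    {g : V →ₗ[k] W} {h : W →ₗ[k] U}
    (hg : IsComodHom β γ g) (hh : IsComodHom γ δ h) : IsComodHom β δ (h ∘ₗ g) := by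
  ext v
  simp only [LinearMap.comp_apply]
  rw [hom_apply hh, hom_apply hg, LinearMap.rTensor_comp_apply]

lemma hom_coassoc {β : V →ₗ[k] V ⊗[k] C} {γ : W →ₗ[k] W ⊗[k] C} {g : V →ₗ[k] W}
    (hg : IsComodHom β γ g) (v : V) :
    TensorProduct.assoc k W C C (γ.rTensor C (γ (g v))) =
      g.rTensor (C ⊗[k] C) (TensorProduct.assoc k V C C (β.rTensor C (β v))) := by
  rw [hom_apply hg]
  generalize β v = z
  induction z with
  | zero => simp
  | add x y hx hy => simp only [map_add, hx, hy]
  | tmul v c =>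
    simp only [LinearMap.rTensor_tmul]
    rw [hom_apply hg]
    generalize β v = z
    induction z with
    | zero => simp
    | add x y hx hy => simp only [map_add, add_tmul, hx, hy]
    | tmul v d => simp

lemma hom_lcomul (g : V →ₗ[k] W) (z : V ⊗[k] C) :
    LinearMap.lTensor W (Coalgebra.comul (R := k) (A := C)) (g.rTensor C z) =
      g.rTensor (C ⊗[k] C) (LinearMap.lTensor V (Coalgebra.comul (R := k) (A := C)) z) := by
  induction z with
  | zero => simp
  | add x y hx hy => simp only [map_add, hx, hy]
  | tmul v d => simp

lemma isComodule_iff (β : V →ₗ[k] V ⊗[k] C) : IsComodule k C β ↔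
    (∀ v, TensorProduct.assoc k V C C (β.rTensor C (β v)) =
      LinearMap.lTensor V (Coalgebra.comul (R := k) (A := C)) (β v)) ∧
    (∀ v, slice V Coalgebra.counit (β v) = v) :=
  ⟨fun h => ⟨fun v => LinearMap.congr_fun h.coassoc v, fun v => LinearMap.congr_fun h.counit_id v⟩,
   fun h => ⟨LinearMap.ext h.1, LinearMap.ext h.2⟩⟩

/-- Restriction of a coaction. -/
lemma exists_restrict {β : V →ₗ[k] V ⊗[k] C} (hβ : IsComodule k C β) {S : Submodule k V}
    (hS : IsSubcomodule β S) : ∃ γ : S →ₗ[k] S ⊗[k] C, IsComodule k C γ ∧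
      IsComodHom γ β S.subtype := by
  have hinj : Function.Injective (S.subtype.rTensor C) :=
    Module.Flat.rTensor_preserves_injective_linearMap _ S.injective_subtype
  have hinj2 : Function.Injective (S.subtype.rTensor (C ⊗[k] C)) :=
    Module.Flat.rTensor_preserves_injective_linearMap _ S.injective_subtype
  let γ : S →ₗ[k] S ⊗[k] C := (LinearEquiv.ofInjective _ hinj).symm.toLinearMap ∘ₗ
    (β ∘ₗ S.subtype).codRestrict _ (fun w => hS w.1 w.2)
  have hγ : IsComodHom γ β S.subtype := by
    ext w
    simp only [LinearMap.comp_apply, γ]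
    have := (LinearEquiv.ofInjective _ hinj).apply_symm_apply
      ((β ∘ₗ S.subtype).codRestrict _ (fun w => hS w.1 w.2) w)
    exact congrArg Subtype.val this
  refine ⟨γ, ?_, hγ⟩
  rw [isComodule_iff] at hβ ⊢
  constructor
  · intro v
    apply hinj2
    rw [← hom_coassoc hγ, ← hom_lcomul, ← hom_apply hγ, hβ.1]
  · intro v
    apply S.injective_subtype
    rw [← hom_slice hγ, hβ.2]

lemma isSub_simple {β : V →ₗ[k] V ⊗[k] C} {S : Submodule k V} {γ : S →ₗ[k] S ⊗[k] C}
    (hγ : IsComodHom γ β S.subtype) (hS : IsSimpleSubcomodule β S) (T : Submodule k S)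
    (hT : IsSubcomodule γ T) : T = ⊥ ∨ T = ⊤ := by
  rcases hS.2.2 (T.map S.subtype) (Submodule.map_subtype_le S T) (isSub_map hγ hT) with h | h
  · left
    apply Submodule.map_injective_of_injective S.injective_subtype
    rw [h]; simp
  · right
    apply Submodule.map_injective_of_injective S.injective_subtype
    rw [h]; simp

/-- The image of a simple subcomodule lies in the socle. -/
lemma map_simple_le {β : V →ₗ[k] V ⊗[k] C} {γ : W →ₗ[k] W ⊗[k] C} {g : V →ₗ[k] W}
    (hg : IsComodHom β γ g) {S : Submodule k V} (hS : IsSimpleSubcomodule β S) :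
    S.map g ≤ socle γ := by
  by_cases h0 : S.map g = ⊥
  · rw [h0]; exact bot_le
  apply le_sSup
  refine ⟨isSub_map hg hS.1, h0, fun X hX hX' => ?_⟩
  rcases hS.2.2 (S ⊓ X.comap g) inf_le_left (isSub_inf hS.1 (isSub_comap hg hX')) with h | h
  · left
    rw [eq_bot_iff]
    intro x hx
    obtain ⟨v, hv, rfl⟩ := hX hx
    have : v ∈ S ⊓ X.comap g := ⟨hv, hx⟩
    rw [h, Submodule.mem_bot] at this
    simp [this]
  · right
    apply le_antisymm hX
    rw [Submodule.map_le_iff_le_comap]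
    exact inf_eq_left.1 h

/-- The cofree coaction. -/
noncomputable def cofree (V : Type) [AddCommGroup V] [Module k V] :
    V ⊗[k] C →ₗ[k] (V ⊗[k] C) ⊗[k] C :=
  (TensorProduct.assoc k V C C).symm.toLinearMap ∘ₗ LinearMap.lTensor V Coalgebra.comul

lemma cofree_tmul (v : V) (c : C) : cofree (C := C) V (v ⊗ₜ[k] c) =
    (TensorProduct.assoc k V C C).symm (v ⊗ₜ[k] Coalgebra.comul c) := by
  simp [cofree]

lemma cofree_isComodule (V : Type) [AddCommGroup V] [Module k V] :
    IsComodule k C (cofree (C := C) V) := by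
  rw [isComodule_iff]
  constructor
  · intro x
    induction x with
    | zero => simp
    | add x y hx hy => simp only [map_add, hx, hy]
    | tmul v c =>
      rw [cofree_tmul]
      have h1 : ∀ z : C ⊗[k] C, (TensorProduct.assoc k (V ⊗[k] C) C C)
          ((cofree (C := C) V).rTensor C ((TensorProduct.assoc k V C C).symm (v ⊗ₜ[k] z))) =
          (TensorProduct.assoc k V C (C ⊗[k] C)).symm (v ⊗ₜ[k]
            (TensorProduct.assoc k C C C (Coalgebra.comul.rTensor C z))) := by
        intro z
        induction z with
        | zero => simp
        | add x y hx hy => simp only [map_add, tmul_add, hx, hy]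
        | tmul a b =>
          simp only [assoc_symm_tmul, LinearMap.rTensor_tmul, cofree_tmul]
          generalize (Coalgebra.comul a : C ⊗[k] C) = z
          induction z with
          | zero => simp
          | add x y hx hy => simp only [map_add, tmul_add, add_tmul, hx, hy]
          | tmul a b => simp
      have h2 : ∀ z : C ⊗[k] C, LinearMap.lTensor (V ⊗[k] C) Coalgebra.comul
          ((TensorProduct.assoc k V C C).symm (v ⊗ₜ[k] z)) =
          (TensorProduct.assoc k V C (C ⊗[k] C)).symm (v ⊗ₜ[k]
            (Coalgebra.comul.lTensor C z)) := by
        intro z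
        induction z with
        | zero => simp
        | add x y hx hy => simp only [map_add, tmul_add, hx, hy]
        | tmul a b => simp
      rw [h1, h2, Coalgebra.coassoc_apply]
  · intro x
    induction x with
    | zero => simp
    | add x y hx hy => simp only [map_add, hx, hy]
    | tmul v c =>
      rw [cofree_tmul]
      have h2 : ∀ z : C ⊗[k] C, slice (V ⊗[k] C) Coalgebra.counit
          ((TensorProduct.assoc k V C C).symm (v ⊗ₜ[k] z)) = v ⊗ₜ[k] slice C Coalgebra.counit z := by
        intro z
        induction z with
        | zero => simp
        | add x y hx hy => simp only [map_add, tmul_add, hx, hy]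
        | tmul a b => simp
      rw [h2]
      congr 1
      simp [slice]

lemma comul_isComodule : IsComodule k C (Coalgebra.comul (R := k) (A := C)) := by
  rw [isComodule_iff]
  exact ⟨fun v => Coalgebra.coassoc_apply v, fun v => by simp [slice]⟩

lemma rTensor_hom {β : V →ₗ[k] V ⊗[k] C} (hβ : IsComodule k C β) (ω : V →ₗ[k] W) :
    IsComodHom β (cofree W) (ω.rTensor C ∘ₗ β) := by
  rw [isComodule_iff] at hβ
  ext v
  simp only [LinearMap.comp_apply, cofree, LinearEquiv.coe_coe]
  rw [hom_lcomul, ← hβ.1, LinearEquiv.eq_symm_apply, LinearMap.rTensor_comp_apply]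
  generalize β.rTensor C (β v) = z
  induction z with
  | zero => simp
  | add x y hx hy => simp only [map_add, hx, hy]
  | tmul v c =>
    induction v with
    | zero => simp
    | add x y hx hy => simp only [map_add, add_tmul, hx, hy]
    | tmul a b => simp

/-- `V` is a retract of `V ⊗ C`. -/
def HasRetr (β : V →ₗ[k] V ⊗[k] C) : Prop :=
  ∃ r : V ⊗[k] C →ₗ[k] V, IsComodHom (cofree V) β r ∧ r ∘ₗ β = LinearMap.id

lemma HasRetr.extend {β : V →ₗ[k] V ⊗[k] C} (h : HasRetr β)
    {δ : U →ₗ[k] U ⊗[k] C} {γ : W →ₗ[k] W ⊗[k] C} (hγ : IsComodule k C γ)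
    {j : U →ₗ[k] W} (hj : IsComodHom δ γ j) (hinj : Function.Injective j)
    {f : U →ₗ[k] V} (hf : IsComodHom δ β f) :
    ∃ f' : W →ₗ[k] V, IsComodHom γ β f' ∧ ∀ u, f' (j u) = f u := by
  obtain ⟨r, hr, hrβ⟩ := h
  obtain ⟨p, hp⟩ := j.exists_leftInverse_of_injective (LinearMap.ker_eq_bot.2 hinj)
  refine ⟨r ∘ₗ (f ∘ₗ p).rTensor C ∘ₗ γ, hom_comp (rTensor_hom hγ _) hr, fun u => ?_⟩
  simp only [LinearMap.comp_apply]
  rw [hom_apply hj, ← LinearMap.rTensor_comp_apply, LinearMap.comp_assoc, hp, LinearMap.comp_id,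
    ← hom_apply hf]
  exact LinearMap.congr_fun hrβ _

lemma hasRetr_comul : HasRetr (Coalgebra.comul (R := k) (A := C)) := by
  refine ⟨(TensorProduct.lid k C).toLinearMap ∘ₗ Coalgebra.counit.rTensor C, ?_, ?_⟩
  · refine TensorProduct.ext' fun a c => ?_
    simp only [LinearMap.comp_apply, cofree_tmul, LinearMap.rTensor_tmul, LinearEquiv.coe_coe,
      TensorProduct.lid_tmul, map_smul]
    generalize (Coalgebra.comul c : C ⊗[k] C) = z
    induction z with
    | zero => simp
    | add x y hx hy => simp only [map_add, tmul_add, smul_add, hx, hy]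
    | tmul x y => simp [smul_tmul']
  · ext c
    simp

lemma hasRetr_of_injective {M : Comod k C} (hM : IsInjectiveComod M) : HasRetr M.β := by
  have hβ := (isComodule_iff _).1 M.isComodule
  have hinj : Function.Injective M.β := by
    intro x y hxy
    rw [← hβ.2 x, ← hβ.2 y, hxy]
  have hh : IsComodHom M.β (cofree M.V) M.β := by
    simpa using rTensor_hom M.isComodule (LinearMap.id (R := k) (M := M.V))
  obtain ⟨X, hX, hc⟩ := hM ⟨M.V ⊗[k] C, cofree M.V, cofree_isComodule M.V⟩ M.β hh hinj
  let r : M.V ⊗[k] C →ₗ[k] M.V := (LinearEquiv.ofInjective M.β hinj).symm.toLinearMap ∘ₗ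
    Submodule.projectionOnto _ _ hc
  have hr : ∀ v, r (M.β v) = v := by
    intro v
    simp only [r, LinearMap.comp_apply, LinearEquiv.coe_coe]
    rw [LinearEquiv.symm_apply_eq]
    exact Submodule.projectionOnto_apply_left hc ⟨M.β v, v, rfl⟩
  have hr0 : ∀ x ∈ X, r x = 0 := by
    intro x hx
    simp only [r, LinearMap.comp_apply, LinearEquiv.coe_coe]
    rw [(Submodule.projectionOnto_apply_eq_zero_iff hc).2 hx, map_zero]
  refine ⟨r, ?_, LinearMap.ext hr⟩
  refine LinearMap.ext fun x => ?_
  have hx : x ∈ LinearMap.range M.β ⊔ X := by rw [hc.sup_eq_top]; trivial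
  obtain ⟨_, ⟨v, rfl⟩, y, hy, rfl⟩ := Submodule.mem_sup.1 hx
  simp only [LinearMap.comp_apply, map_add, hr, hr0 y hy, map_zero, add_zero]
  have h1 : r.rTensor C (cofree M.V (M.β v)) = M.β v := by
    rw [hom_apply hh, ← LinearMap.rTensor_comp_apply,
      (LinearMap.ext hr : r ∘ₗ M.β = LinearMap.id)]
    simp
  have h2 : r.rTensor C (cofree M.V y) = 0 := by
    obtain ⟨z, hz⟩ := hX y hy
    change (X.subtype.rTensor C) z = cofree M.V y at hz
    rw [← hz, ← LinearMap.rTensor_comp_apply]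
    have : r ∘ₗ X.subtype = 0 := LinearMap.ext fun w => hr0 w.1 w.2
    rw [this]; simp
  rw [h1, h2, add_zero]

end helpers

section ds

set_option linter.unusedSectionVars false

variable {ι' : Type} [DecidableEq ι'] {Vf : ι' → Type}
    [∀ i, AddCommGroup (Vf i)] [∀ i, Module k (Vf i)]
    {βf : ∀ i, Vf i →ₗ[k] Vf i ⊗[k] C}
    {W : Type} [AddCommGroup W] [Module k W]

lemma lof_hom (i : ι') :
    IsComodHom (βf i) (dsCoaction Vf βf) (DirectSum.lof k ι' Vf i) := by
  ext x
  simp only [dsCoaction, LinearMap.comp_apply]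
  have : (fun a b => Classical.propDecidable (a = b)) = (inferInstance : DecidableEq ι') :=
    Subsingleton.elim _ _
  have h2 : Classical.decEq ι' = (inferInstance : DecidableEq ι') := Subsingleton.elim _ _
  rw [h2]
  erw [DirectSum.toModule_lof]
  rfl

lemma hom_of_lof {γ : W →ₗ[k] W ⊗[k] C} {g : (⨁ i, Vf i) →ₗ[k] W}
    (h : ∀ i, IsComodHom (βf i) γ (g ∘ₗ DirectSum.lof k ι' Vf i)) :
    IsComodHom (dsCoaction Vf βf) γ g := by
  refine DirectSum.linearMap_ext _ fun i => LinearMap.ext fun x => ?_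
  simp only [LinearMap.comp_apply]
  rw [hom_apply (lof_hom i), ← LinearMap.rTensor_comp_apply, ← hom_apply (h i)]
  rfl

lemma component_hom (i : ι') :
    IsComodHom (dsCoaction Vf βf) (βf i) (DirectSum.component k ι' Vf i) := by
  apply hom_of_lof
  intro j
  by_cases hij : j = i
  · subst hij
    have : DirectSum.component k ι' Vf j ∘ₗ DirectSum.lof k ι' Vf j = LinearMap.id := by
      ext x; simp [DirectSum.component.lof_self]
    rw [this]
    ext x; simp
  · have : DirectSum.component k ι' Vf i ∘ₗ DirectSum.lof k ι' Vf j = 0 := by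
      ext x
      simp [DirectSum.component.of, hij]
    rw [this]
    ext x; simp

lemma ds_isComodule (h : ∀ i, IsComodule k C (βf i)) : IsComodule k C (dsCoaction Vf βf) := by
  constructor
  · refine DirectSum.linearMap_ext _ fun i => LinearMap.ext fun x => ?_
    simp only [LinearMap.comp_apply, LinearEquiv.coe_coe]
    rw [hom_coassoc (lof_hom i), ((isComodule_iff _).1 (h i)).1, hom_apply (lof_hom i), hom_lcomul]
  · refine DirectSum.linearMap_ext _ fun i => LinearMap.ext fun x => ?_
    have := hom_slice (lof_hom (βf := βf) i) Coalgebra.counit x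
    rw [((isComodule_iff _).1 (h i)).2] at this
    exact this

lemma ds_hasRetr (h : ∀ i, HasRetr (βf i)) : HasRetr (dsCoaction Vf βf) := by
  choose r hr hr' using h
  let R : (⨁ i, Vf i) ⊗[k] C →ₗ[k] ⨁ i, Vf i :=
    TensorProduct.lift (DirectSum.toModule k ι' _ fun i =>
      TensorProduct.curry (DirectSum.lof k ι' Vf i ∘ₗ r i))
  have hR : ∀ i, R ∘ₗ (DirectSum.lof k ι' Vf i).rTensor C = DirectSum.lof k ι' Vf i ∘ₗ r i := by
    intro i
    refine TensorProduct.ext' fun x c => ?_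
    simp [R]
  have hR' : ∀ i x, R ((DirectSum.lof k ι' Vf i).rTensor C x) = DirectSum.lof k ι' Vf i (r i x) :=
    fun i x => LinearMap.congr_fun (hR i) x
  have hcof : ∀ i x, cofree (C := C) (⨁ i, Vf i) ((DirectSum.lof k ι' Vf i).rTensor C x) =
      ((DirectSum.lof k ι' Vf i).rTensor C).rTensor C (cofree (Vf i) x) := by
    intro i x
    induction x with
    | zero => simp
    | add x y hx hy => simp only [map_add, hx, hy]
    | tmul v c =>
      rw [LinearMap.rTensor_tmul, cofree_tmul, cofree_tmul]
      generalize (Coalgebra.comul c : C ⊗[k] C) = z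
      induction z with
      | zero => simp
      | add x y hx hy => simp only [map_add, tmul_add, hx, hy]
      | tmul a b => simp
  refine ⟨R, ?_, ?_⟩
  · refine TensorProduct.ext' fun x c => ?_
    induction x using DirectSum.induction_on with
    | zero => simp
    | add x y hx hy => simp only [add_tmul, map_add, hx, hy]
    | of i x =>
      have : (DirectSum.of Vf i x) ⊗ₜ[k] c = (DirectSum.lof k ι' Vf i).rTensor C (x ⊗ₜ[k] c) := by
        simp [DirectSum.lof_eq_of]
      rw [this]
      simp only [LinearMap.comp_apply]
      rw [hcof, hR', hom_apply (lof_hom i), hom_apply (hr i), ← LinearMap.rTensor_comp_apply, hR,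
        ← LinearMap.rTensor_comp_apply]
  · refine DirectSum.linearMap_ext _ fun i => LinearMap.ext fun x => ?_
    simp only [LinearMap.comp_apply]
    rw [hom_apply (lof_hom i), hR']
    have := LinearMap.congr_fun (hr' i) x
    simp only [LinearMap.comp_apply] at this
    rw [this]
    rfl

lemma ds_socle_le : socle (dsCoaction Vf βf) ≤
    ⨆ i, (socle (βf i)).map (DirectSum.lof k ι' Vf i) := by
  classical
  apply sSup_le
  intro S hS x hx
  rw [← DirectSum.sum_support_of x]
  refine Submodule.sum_mem _ fun i _ => ?_
  apply Submodule.mem_iSup_of_mem i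
  refine ⟨x i, map_simple_le (component_hom i) hS ⟨x, hx, rfl⟩, rfl⟩

end ds

/-- Green's structure theorem for coalgebras: given a full set `F` of indecomposable
injective covers of the simple `C`-comodules, there are multiplicities `μ` (possibly
zero, the nonzero ones forming the subfamily `F'`) such that `C ≅ ⊕_{I ∈ F'} μ_I I` as
right `C`-comodules, the isomorphism carrying the socle `σ(C)` onto
`⊕_{I ∈ F'} μ_I σ(I)`. -/
theorem green_structure_theorem
    {ι : Type} (F₀ F : ι → Comod k C)
    (hsimple : ∀ i, IsSimpleComod (F₀ i))
    (hfull : ∀ M : Comod k C, IsSimpleComod M →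
      ∃ i, ∃ e : M.V ≃ₗ[k] (F₀ i).V, IsComodHom M.β (F₀ i).β e.toLinearMap)
    (hsep : ∀ i j, (∃ e : (F₀ i).V ≃ₗ[k] (F₀ j).V,
      IsComodHom (F₀ i).β (F₀ j).β e.toLinearMap) → i = j)
    (hcover : ∀ i, IsInjectiveCover (F i) (F₀ i)) :
    ∃ (μ : ι → Type) (e : C ≃ₗ[k] ⨁ p : Σ i, μ i, (F p.1).V),
      IsComodHom (Coalgebra.comul (R := k) (A := C))
        (dsCoaction (fun p : Σ i, μ i => (F p.1).V) (fun p => (F p.1).β))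
        e.toLinearMap ∧
      Submodule.map e.toLinearMap (socle (Coalgebra.comul (R := k) (A := C))) =
        ⨆ p : Σ i, μ i,
          Submodule.map
            (letI := Classical.decEq (Σ i, μ i)
             DirectSum.lof k (Σ i, μ i) (fun q => (F q.1).V) p)
            (socle (F p.1).β) := by
  obtain ⟨s, hind, hsimp, hsup⟩ := exists_indep (Coalgebra.comul (R := k) (A := C))
  have key : ∀ S : s, ∃ γ : S.1 →ₗ[k] S.1 ⊗[k] C,
      IsComodHom γ (Coalgebra.comul (R := k) (A := C)) S.1.subtype ∧
      ∃ i, ∃ h : S.1 →ₗ[k] (F i).V, IsComodHom γ (F i).β h ∧ Function.Injective h ∧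
        LinearMap.range h = socle (F i).β := by
    rintro ⟨S, hS⟩
    have hSs := hsimp S hS
    obtain ⟨γ, hγ, hγ'⟩ := exists_restrict comul_isComodule hSs.1
    refine ⟨γ, hγ', ?_⟩
    obtain ⟨i, e, he⟩ := hfull ⟨S, γ, hγ⟩
      ⟨(Submodule.nontrivial_iff_ne_bot).2 hSs.2.1, fun T hT => isSub_simple hγ' hSs T hT⟩
    obtain ⟨-, -, g, hg, hgi, hgr⟩ := hcover i
    refine ⟨i, g ∘ₗ e.toLinearMap, hom_comp he hg, ?_, ?_⟩
    · exact hgi.comp e.injective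
    · rw [← hgr]
      exact LinearMap.range_comp_of_range_eq_top _ e.range
  choose γ hγ idx h0 h0hom h0inj h0range using key
  let μ : ι → Type := fun i => {S : s // idx S = i}
  have hp : ∀ p : Σ i, μ i, ∃ h : p.2.1.1 →ₗ[k] (F p.1).V, IsComodHom (γ p.2.1) (F p.1).β h ∧
      Function.Injective h ∧ LinearMap.range h = socle (F p.1).β := by
    rintro ⟨i, S, rfl⟩
    exact ⟨h0 S, h0hom S, h0inj S, h0range S⟩
  choose h hhom hinj hrange using hp
  letI := Classical.decEq (Σ i, μ i)
  let P : (Σ i, μ i) → Submodule k C := fun p => p.2.1.1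
  have hPind : iSupIndep P := by
    have h1 : iSupIndep (fun S : s => (S : Submodule k C)) := (sSupIndep_iff s).1 hind
    refine h1.comp (f := fun p : Σ i, μ i => p.2.1) ?_
    rintro ⟨i, S, rfl⟩ ⟨j, T, rfl⟩ hST
    change S = T at hST
    subst hST
    rfl
  have hPsup : ⨆ p, P p = socle (Coalgebra.comul (R := k) (A := C)) := by
    rw [← hsup]
    apply le_antisymm
    · exact iSup_le fun p => le_sSup p.2.1.2
    · exact sSup_le fun S hS => le_iSup P ⟨idx ⟨S, hS⟩, ⟨S, hS⟩, rfl⟩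
  let j : (⨁ p, P p) →ₗ[k] C := DirectSum.toModule k _ C fun p => (P p).subtype
  have hjlof : ∀ p (x : P p), j (DirectSum.lof k _ (fun p => P p) p x) = x := by
    intro p x
    exact DirectSum.toModule_lof (M := fun p => P p) k p x
  have hjinj : Function.Injective j := hPind.dfinsupp_lsum_injective
  have hjrange : LinearMap.range j = socle (Coalgebra.comul (R := k) (A := C)) := by
    rw [← hPsup]
    exact (Submodule.iSup_eq_range_dfinsupp_lsum P).symm
  have hjhom : IsComodHom (dsCoaction (fun p => P p) (fun p => γ p.2.1))
      (Coalgebra.comul (R := k) (A := C)) j := by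
    apply hom_of_lof
    intro p
    have : j ∘ₗ DirectSum.lof k _ (fun p => P p) p = (P p).subtype :=
      LinearMap.ext (hjlof p)
    rw [this]
    exact hγ p.2.1
  let E := dsCoaction (fun p : Σ i, μ i => (F p.1).V) (fun p => (F p.1).β)
  have hE : IsComodule k C E := ds_isComodule fun p => (F p.1).isComodule
  have hEr : HasRetr E := ds_hasRetr fun p => hasRetr_of_injective (hcover p.1).2.1
  let f0 : (⨁ p, P p) →ₗ[k] ⨁ p : Σ i, μ i, (F p.1).V := DirectSum.lmap h
  have hf0lof : ∀ p (x : P p), f0 (DirectSum.lof k _ (fun p => P p) p x) =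
      DirectSum.lof k _ (fun p : Σ i, μ i => (F p.1).V) p (h p x) := fun p x =>
    DirectSum.lmap_lof h p x
  have hf0inj : Function.Injective f0 := (DirectSum.lmap_injective h).2 hinj
  have hf0hom : IsComodHom (dsCoaction (fun p => P p) (fun p => γ p.2.1)) E f0 := by
    apply hom_of_lof
    intro p
    have : f0 ∘ₗ DirectSum.lof k _ (fun p => P p) p =
      DirectSum.lof k _ (fun p : Σ i, μ i => (F p.1).V) p ∘ₗ h p := LinearMap.ext (hf0lof p)
    rw [this]
    exact hom_comp (hhom p)
      (lof_hom (Vf := fun p : Σ i, μ i => (F p.1).V) (βf := fun p => (F p.1).β) p)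
  obtain ⟨f, hf, hfj⟩ := hEr.extend comul_isComodule hjhom hjinj hf0hom
  have hfinj : LinearMap.ker f = ⊥ := by
    apply eq_bot_of_disjoint_socle comul_isComodule (isSub_ker hf)
    rw [eq_bot_iff]
    rintro x ⟨hx1, hx2⟩
    rw [← hjrange] at hx2
    obtain ⟨y, rfl⟩ := hx2
    have : f0 y = 0 := by rw [← hfj]; exact hx1
    rw [hf0inj (this.trans (map_zero f0).symm)]
    simp
  have hmap : Submodule.map f (socle (Coalgebra.comul (R := k) (A := C))) =
      ⨆ p : Σ i, μ i, Submodule.map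
        (DirectSum.lof k (Σ i, μ i) (fun q => (F q.1).V) p) (socle (F p.1).β) := by
    rw [← hPsup, Submodule.map_iSup]
    refine iSup_congr fun p => ?_
    rw [← hrange p, ← LinearMap.range_comp]
    ext y
    constructor
    · rintro ⟨x, hx, rfl⟩
      refine ⟨⟨x, hx⟩, ?_⟩
      rw [LinearMap.comp_apply]
      erw [← hf0lof p ⟨x, hx⟩]
      rw [← hfj, hjlof]
    · rintro ⟨x, rfl⟩
      refine ⟨x.1, x.2, ?_⟩
      rw [LinearMap.comp_apply]
      erw [← hf0lof p x]
      rw [← hfj, hjlof]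
  obtain ⟨g, hg, hgf⟩ := (hasRetr_comul (k := k) (C := C)).extend hE hf
    (LinearMap.ker_eq_bot.1 hfinj) (f := LinearMap.id) (by ext x; simp)
  have hginj : LinearMap.ker g = ⊥ := by
    apply eq_bot_of_disjoint_socle hE (isSub_ker hg)
    rw [eq_bot_iff]
    rintro x ⟨hx1, hx2⟩
    have hx3 := ds_socle_le hx2
    rw [← hmap] at hx3
    obtain ⟨y, -, rfl⟩ := hx3
    have : y = 0 := (hgf y).symm.trans hx1
    simp [this]
  have hfsurj : Function.Surjective f := fun y =>
    ⟨g y, LinearMap.ker_eq_bot.1 hginj (hgf (g y))⟩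
  exact ⟨μ, LinearEquiv.ofBijective f ⟨LinearMap.ker_eq_bot.1 hfinj, hfsurj⟩, hf, hmap⟩

end SuperCoalg
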